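/- Let A, B ∈ ℝ^{n×n} be symmetric matrices that are isospectral and friendly: A and B each have n distinct eigenvalues, the eigenvalues of A and B coincide, and every eigenvector u of A and every eigenvector v of B satisfies ⟨u, 𝟙_n⟩ ≠ 0. Then there exists at most one doubly stochastic matrix X ∈ ℝ^{n×n} with X·A = B·X. -/

import Mathlib

open Matrix BigOperators

/-- A doubly stochastic matrix: nonnegative entries, all row and column sums equal 1. -/
def IsDoublyStochastic {n : ℕ} (X : Matrix (Fin n) (Fin n) ℝ) : Prop :=
  (∀ i j, 0 ≤ X i j) ∧ (∀ i, ∑ j, X i j = 1) ∧ (∀ j, ∑ i, X i j = 1)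

/-- A matrix that kills `n` eigenvectors of `A` belonging to distinct eigenvalues is zero. -/
theorem eq_zero_of_mulVec_eigenvectors_eq_zero {n : ℕ} {A D : Matrix (Fin n) (Fin n) ℝ}
    {lam : Fin n → ℝ} (hlam : Function.Injective lam) {u : Fin n → Fin n → ℝ}
    (hu : ∀ k, u k ≠ 0) (hAu : ∀ k, A *ᵥ u k = lam k • u k) (hD : ∀ k, D *ᵥ u k = 0) :
    D = 0 := by
  have hli : LinearIndependent ℝ u :=
    Module.End.eigenvectors_linearIndependent' A.mulVecLin lam hlam u fun k =>
      ⟨Module.End.mem_eigenspace_iff.mpr (by simpa using hAu k), hu k⟩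
  have hspan : Submodule.span ℝ (Set.range u) = ⊤ :=
    hli.span_eq_top_of_card_eq_finrank' (by simp)
  have hzero : D.mulVecLin = 0 := by
    refine LinearMap.ext_on_range hspan fun k => ?_
    simpa using hD k
  exact Matrix.ext_of_mulVec_single fun i => by
    rw [zero_mulVec]
    exact LinearMap.congr_fun hzero (Pi.single i 1)

/-- If `D` intertwines `A` and `B` and has zero column sums, and no eigenvector of `B` is
orthogonal to the all-ones vector, then `D` kills every eigenvector of `A`. -/
theorem mulVec_eigenvector_eq_zero_of_intertwines {n : ℕ} {A B D : Matrix (Fin n) (Fin n) ℝ}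
    (hD : D * A = B * D) (hcol : ∀ j, ∑ i, D i j = 0)
    (hB : ∀ (c : ℝ) (v : Fin n → ℝ), v ≠ 0 → B *ᵥ v = c • v →
      v ⬝ᵥ (fun _ => (1 : ℝ)) ≠ 0)
    {c : ℝ} {u : Fin n → ℝ} (hu : A *ᵥ u = c • u) : D *ᵥ u = 0 := by
  by_contra hne
  refine hB c (D *ᵥ u) hne ?_ ?_
  · rw [mulVec_mulVec, ← hD, ← mulVec_mulVec, hu, mulVec_smul]
  · have hvec : (fun _ => (1 : ℝ)) ᵥ* D = 0 := by
      ext j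
      simpa [vecMul, dotProduct] using hcol j
    rw [dotProduct_comm, dotProduct_mulVec, hvec, zero_dotProduct]

/-- If `A, B` are symmetric, isospectral with `n` distinct common
eigenvalues, and friendly (every eigenvector of `A` and of `B` has nonzero inner
product with the all-ones vector), then there is at most one doubly stochastic matrix
`X` with `XA = BX`. -/
theorem friendly_isospectral_unique_solution
    (n : ℕ) (A B : Matrix (Fin n) (Fin n) ℝ) (hA : A.IsSymm) (hB : B.IsSymm)
    (lam : Fin n → ℝ) (hlam : Function.Injective lam)
    (hAeig : ∀ k, ∃ u : Fin n → ℝ, u ≠ 0 ∧ A *ᵥ u = lam k • u)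
    (hBeig : ∀ k, ∃ v : Fin n → ℝ, v ≠ 0 ∧ B *ᵥ v = lam k • v)
    (hAfriendly : ∀ (c : ℝ) (u : Fin n → ℝ), u ≠ 0 → A *ᵥ u = c • u →
      u ⬝ᵥ (fun _ => (1 : ℝ)) ≠ 0)
    (hBfriendly : ∀ (c : ℝ) (v : Fin n → ℝ), v ≠ 0 → B *ᵥ v = c • v →
      v ⬝ᵥ (fun _ => (1 : ℝ)) ≠ 0) :
    ∀ X Y : Matrix (Fin n) (Fin n) ℝ,
      IsDoublyStochastic X → X * A = B * X →
      IsDoublyStochastic Y → Y * A = B * Y → X = Y := by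
  intro X Y hX hXA hY hYA
  choose u hu hAu using hAeig
  have hcol : ∀ j, ∑ i, (X - Y) i j = 0 := fun j => by
    simp [Finset.sum_sub_distrib, hX.2.2 j, hY.2.2 j]
  have hD : (X - Y) * A = B * (X - Y) := by rw [sub_mul, mul_sub, hXA, hYA]
  exact sub_eq_zero.mp (eq_zero_of_mulVec_eigenvectors_eq_zero hlam hu hAu fun k =>
    mulVec_eigenvector_eq_zero_of_intertwines hD hcol hBfriendly (hAu k))
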